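/- arXiv:math/9912125 — 4 statements merged into one kernel-verified Lean document; each statement's English description precedes it below -/
import Mathlib

section
/- For every permutation w in S_n (identified with its permutation matrix) and every lower unitriangular matrix x ∈ N_-, there exist a ∈ N_- and b ∈ N such that w⁻¹ x w = a·b; the same conclusion holds for every upper unitriangular matrix x ∈ N. Consequently, every element of w⁻¹ B_- w and every element of w⁻¹ B w admits a Gaussian decomposition, i.e. w⁻¹ B_- w ⊆ G_0 and w⁻¹ B w ⊆ G_0. -/
open scoped Classical

namespace BruhatTNN

abbrev Mat (n : ℕ) := Matrix (Fin n) (Fin n) ℝ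

/-- `x` is upper unitriangular. -/
def upperUni {n : ℕ} (x : Mat n) : Prop :=
  (∀ i, x i i = 1) ∧ ∀ i j : Fin n, j < i → x i j = 0

/-- `x` is lower unitriangular. -/
def lowerUni {n : ℕ} (x : Mat n) : Prop :=
  (∀ i, x i i = 1) ∧ ∀ i j : Fin n, i < j → x i j = 0

/-- `x` is invertible upper triangular (`x ∈ B`). -/
def upperTriInv {n : ℕ} (x : Mat n) : Prop :=
  IsUnit x.det ∧ ∀ i j : Fin n, j < i → x i j = 0

/-- `x` is invertible lower triangular (`x ∈ B_-`). -/
def lowerTriInv {n : ℕ} (x : Mat n) : Prop :=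
  IsUnit x.det ∧ ∀ i j : Fin n, i < j → x i j = 0

/-- `x` is invertible diagonal (`x ∈ H`). -/
def diagInv {n : ℕ} (x : Mat n) : Prop :=
  IsUnit x.det ∧ ∀ i j : Fin n, i ≠ j → x i j = 0

/-- `x` admits a Gaussian decomposition (`x ∈ G_0`). -/
def hasGauss {n : ℕ} (x : Mat n) : Prop :=
  ∃ a d b : Mat n, lowerUni a ∧ diagInv d ∧ upperUni b ∧ x = a * d * b

/-- The factor `[x]_-` of the Gaussian decomposition (junk value `1` if none exists). -/
noncomputable def gaussMinus {n : ℕ} (x : Mat n) : Mat n :=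
  if h : hasGauss x then h.choose else 1

/-- The factor `[x]_0` of the Gaussian decomposition (junk value `1` if none exists). -/
noncomputable def gaussDiag {n : ℕ} (x : Mat n) : Mat n :=
  if h : hasGauss x then h.choose_spec.choose else 1

/-- The factor `[x]_+` of the Gaussian decomposition (junk value `1` if none exists). -/
noncomputable def gaussPlus {n : ℕ} (x : Mat n) : Mat n :=
  if h : hasGauss x then h.choose_spec.choose_spec.choose else 1

/-- The permutation matrix of `w`, with entry `1` in position `(w j, j)`. -/
def permMat {n : ℕ} (w : Equiv.Perm (Fin n)) : Mat n :=
  Matrix.of fun i j => if i = w j then (1 : ℝ) else 0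

/-- The minor of `x` with row set `I` and column set `J` (taken in increasing order). -/
def minorOf {n : ℕ} (x : Mat n) (k : ℕ) (I J : Finset (Fin n))
    (hI : I.card = k) (hJ : J.card = k) : ℝ :=
  Matrix.det (Matrix.of fun a b : Fin k => x (I.orderEmbOfFin hI a) (J.orderEmbOfFin hJ b))

/-- `x` is totally nonnegative: all its minors are nonnegative. -/
def totNonneg {n : ℕ} (x : Mat n) : Prop :=
  ∀ (k : ℕ) (I J : Finset (Fin n)) (hI : I.card = k) (hJ : J.card = k),
    0 ≤ minorOf x k I J hI hJ

/-- The Bruhat order on the symmetric group. -/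
def bruhatLE {n : ℕ} (u v : Equiv.Perm (Fin n)) : Prop :=
  ∀ i j : Fin n,
    (Finset.univ.filter fun k : Fin n => k ≤ i ∧ j ≤ u k).card ≤
    (Finset.univ.filter fun k : Fin n => k ≤ i ∧ j ≤ v k).card

/-- The double coset `B_- w B_-`. -/
def doubleCosetBm {n : ℕ} (w : Equiv.Perm (Fin n)) : Set (Mat n) :=
  {x | ∃ b₁ b₂ : Mat n, lowerTriInv b₁ ∧ lowerTriInv b₂ ∧ x = b₁ * permMat w * b₂}

/-- `N^w = B_- w B_- ∩ N`. -/
def Ncell {n : ℕ} (w : Equiv.Perm (Fin n)) : Set (Mat n) :=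
  {x | upperUni x ∧ x ∈ doubleCosetBm w}

/-- `N_-(w) = w⁻¹ N w ∩ N_-`. -/
def Nminus {n : ℕ} (w : Equiv.Perm (Fin n)) : Set (Mat n) :=
  {x | lowerUni x ∧ ∃ y : Mat n, upperUni y ∧ x = permMat w⁻¹ * y * permMat w}

/-- `N(w) = w⁻¹ N w ∩ N`. -/
def Ngrp {n : ℕ} (w : Equiv.Perm (Fin n)) : Set (Mat n) :=
  {x | upperUni x ∧ ∃ y : Mat n, upperUni y ∧ x = permMat w⁻¹ * y * permMat w}

/-- The totally positive cell `Y°_w = Y ∩ B_- w B_-`. -/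
def Ycirc {n : ℕ} (w : Equiv.Perm (Fin n)) : Set (Mat n) :=
  {x | upperUni x ∧ totNonneg x ∧ x ∈ doubleCosetBm w}

/-- `Y_{≥ u} = ⋃_{v ≥ u} Y°_v`. -/
def Yge {n : ℕ} (u : Equiv.Perm (Fin n)) : Set (Mat n) :=
  {x | ∃ v, bruhatLE u v ∧ x ∈ Ycirc v}

/-- `A = u⁻¹ [x u⁻¹]_+ u`. -/
noncomputable def Amat {n : ℕ} (u : Equiv.Perm (Fin n)) (x : Mat n) : Mat n :=
  permMat u⁻¹ * gaussPlus (x * permMat u⁻¹) * permMat u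

/-- The projection `π_u(x) = [u [u⁻¹ [x u⁻¹]_+ u]_-]_+`. -/
noncomputable def piMap {n : ℕ} (u : Equiv.Perm (Fin n)) (x : Mat n) : Mat n :=
  gaussPlus (permMat u * gaussMinus (Amat u x))

/-- `str(M)`: the sum of the matrix entries immediately above the main diagonal. -/
def strAbove {n : ℕ} (M : Mat n) : ℝ :=
  ∑ p : Fin n × Fin n, if (p.1 : ℕ) + 1 = (p.2 : ℕ) then M p.1 p.2 else 0

/-- The number of inversions (the length) of a permutation. -/
def invNum {n : ℕ} (w : Equiv.Perm (Fin n)) : ℕ :=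
  (Finset.univ.filter fun p : Fin n × Fin n => p.1 < p.2 ∧ w p.2 < w p.1).card

/-- A matrix that is unitriangular for the order pulled back along an injective map
has an `LU` factorization with unitriangular factors. -/
lemma exists_lowerUni_mul_upperUni {α : Type*} [LinearOrder α] :
    ∀ {n : ℕ} (f : Fin n → α), Function.Injective f → ∀ M : Mat n, (∀ i, M i i = 1) →
      (∀ i j, f i < f j → M i j = 0) → ∃ a b : Mat n, lowerUni a ∧ upperUni b ∧ M = a * b
  | 0, _, _, M, _, _ =>
    ⟨M, M, ⟨fun i => i.elim0, fun i => i.elim0⟩, ⟨fun i => i.elim0, fun i => i.elim0⟩,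
      Subsingleton.elim _ _⟩
  | n + 1, f, hf, M, h1, h0 => by
    have hS : ∀ i j : Fin n, f i.succ ≤ f j.succ → M i.succ 0 * M 0 j.succ = 0 := by
      intro i j hij
      rcases lt_or_ge (f i.succ) (f 0) with h | h
      · rw [h0 _ _ h, zero_mul]
      · have hne : f 0 ≠ f i.succ := fun e => Fin.succ_ne_zero i (hf e).symm
        rw [h0 0 j.succ ((lt_of_le_of_ne h hne).trans_le hij), mul_zero]
    obtain ⟨a, b, ha, hb, hab⟩ := exists_lowerUni_mul_upperUni (fun i : Fin n => f i.succ)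
      (hf.comp (Fin.succ_injective n))
      (Matrix.of fun i j => M i.succ j.succ - M i.succ 0 * M 0 j.succ)
      (fun i => by simp [h1, hS i i le_rfl])
      (fun i j hij => by simp [h0 _ _ hij, hS i j hij.le])
    refine ⟨Matrix.of (Fin.cons (Fin.cons 1 0) fun i => Fin.cons (M i.succ 0) (a i)),
      Matrix.of (Fin.cons (Fin.cons 1 fun j => M 0 j.succ) fun i => Fin.cons 0 (b i)),
      ⟨?_, ?_⟩, ⟨?_, ?_⟩, ?_⟩
    · intro i
      cases i using Fin.cases <;> simp [ha.1]
    · intro i j hij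
      cases i using Fin.cases <;> cases j using Fin.cases
      · simp at hij
      · simp
      · simp at hij
      · simpa using ha.2 _ _ (Fin.succ_lt_succ_iff.1 hij)
    · intro i
      cases i using Fin.cases <;> simp [hb.1]
    · intro i j hij
      cases i using Fin.cases <;> cases j using Fin.cases
      · simp at hij
      · simp at hij
      · simp
      · simpa using hb.2 _ _ (Fin.succ_lt_succ_iff.1 hij)
    · ext i j
      rw [Matrix.mul_apply, Fin.sum_univ_succ]
      cases i using Fin.cases with
      | zero => cases j using Fin.cases <;> simp [h1]
      | succ i =>
        cases j using Fin.cases with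
        | zero => simp
        | succ j =>
          have h := congrFun (congrFun hab i) j
          rw [Matrix.mul_apply, Matrix.of_apply] at h
          simp only [Matrix.of_apply, Fin.cons_succ, Fin.cons_zero]
          linarith

/-- A matrix with nonzero diagonal that is triangular for the order pulled back along an
injective map has a Gaussian decomposition. -/
lemma hasGauss_of_triangular {α : Type*} [LinearOrder α] {n : ℕ} (f : Fin n → α)
    (hf : Function.Injective f) (M : Mat n) (h1 : ∀ i, M i i ≠ 0)
    (h0 : ∀ i j, f i < f j → M i j = 0) : hasGauss M := by
  obtain ⟨a, b, ha, hb, hab⟩ := exists_lowerUni_mul_upperUni f hf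
    (Matrix.of fun i j => M i j / M j j) (fun i => by simp [h1])
    (fun i j hij => by simp [h0 _ _ hij])
  refine ⟨a, Matrix.diagonal fun i => M i i,
    Matrix.of fun i j => (M i i)⁻¹ * b i j * M j j, ha, ⟨?_, ?_⟩, ⟨?_, ?_⟩, ?_⟩
  · rw [Matrix.det_diagonal, isUnit_iff_ne_zero]
    exact Finset.prod_ne_zero_iff.2 fun i _ => h1 i
  · intro i j hij
    exact Matrix.diagonal_apply_ne _ hij
  · intro i
    simp [hb.1, h1]
  · intro i j hij
    simp [hb.2 i j hij]
  · ext i j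
    have h := congrFun (congrFun hab i) j
    rw [Matrix.of_apply, div_eq_iff (h1 j), Matrix.mul_apply, Finset.sum_mul] at h
    rw [h, Matrix.mul_apply]
    refine Finset.sum_congr rfl fun k _ => ?_
    rw [Matrix.mul_diagonal, Matrix.of_apply]
    field_simp [h1 k]

/-- Conjugation by a permutation matrix permutes the indices. -/
lemma permMat_inv_mul_mul_permMat {n : ℕ} (w : Equiv.Perm (Fin n)) (x : Mat n) :
    permMat w⁻¹ * x * permMat w = x.submatrix w w := by
  ext i j
  simp [permMat, Matrix.mul_apply, Equiv.eq_symm_apply]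

lemma lowerTriInv.diag_ne_zero {n : ℕ} {x : Mat n} (hx : lowerTriInv x) (i : Fin n) :
    x i i ≠ 0 := by
  have h := hx.1.ne_zero
  rw [Matrix.det_of_isLowerTriangular x fun i j hij => hx.2 i j hij] at h
  exact Finset.prod_ne_zero_iff.1 h i (Finset.mem_univ i)

lemma upperTriInv.diag_ne_zero {n : ℕ} {x : Mat n} (hx : upperTriInv x) (i : Fin n) :
    x i i ≠ 0 := by
  have h := hx.1.ne_zero
  rw [Matrix.det_of_isUpperTriangular fun i j hij => hx.2 i j hij] at h
  exact Finset.prod_ne_zero_iff.1 h i (Finset.mem_univ i)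

theorem statement0 (n : ℕ) (hn : 1 ≤ n) (w : Equiv.Perm (Fin n)) :
    (∀ x : Mat n, lowerUni x →
      ∃ a b : Mat n, lowerUni a ∧ upperUni b ∧ permMat w⁻¹ * x * permMat w = a * b) ∧
    (∀ x : Mat n, upperUni x →
      ∃ a b : Mat n, lowerUni a ∧ upperUni b ∧ permMat w⁻¹ * x * permMat w = a * b) ∧
    (∀ x : Mat n, lowerTriInv x → hasGauss (permMat w⁻¹ * x * permMat w)) ∧
    (∀ x : Mat n, upperTriInv x → hasGauss (permMat w⁻¹ * x * permMat w)) := by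
  have hd : Function.Injective fun i => OrderDual.toDual (w i) :=
    OrderDual.toDual.injective.comp w.injective
  simp only [permMat_inv_mul_mul_permMat]
  refine ⟨fun x hx => ?_, fun x hx => ?_, fun x hx => ?_, fun x hx => ?_⟩
  · exact exists_lowerUni_mul_upperUni w w.injective _ (fun i => hx.1 _)
      fun i j hij => hx.2 _ _ hij
  · exact exists_lowerUni_mul_upperUni _ hd _ (fun i => hx.1 _) fun i j hij => hx.2 _ _ hij
  · exact hasGauss_of_triangular w w.injective _ (fun i => hx.diag_ne_zero _)
      fun i j hij => hx.2 _ _ hij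
  · exact hasGauss_of_triangular _ hd _ (fun i => hx.diag_ne_zero _) fun i j hij => hx.2 _ _ hij

end BruhatTNN
end

section
/- Let w ∈ S_n and let z be an invertible n×n real matrix with w z w⁻¹ ∈ B_-. Then z admits a Gaussian decomposition, and both [z]_- and [z]_+ belong to w⁻¹ N_- w. Analogously, if w z w⁻¹ ∈ B, then z admits a Gaussian decomposition and both [z]_- and [z]_+ belong to w⁻¹ N w. -/
open scoped Classical

namespace BruhatTNN

/-- A matrix with nonzero diagonal entries that is triangular with respect to an injective
relabelling of the indices has a Gaussian decomposition. -/
theorem exists_gauss_of_triangular {α : Type*} [LinearOrder α] :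
    ∀ {n : ℕ} (p : Fin n → α), Function.Injective p → ∀ z : Mat n,
      (∀ i, z i i ≠ 0) → (∀ i j, p i < p j → z i j = 0) →
      ∃ (a b : Mat n) (d : Fin n → ℝ), lowerUni a ∧ upperUni b ∧ (∀ i, d i ≠ 0) ∧
        ∀ i j, z i j = ∑ k, a i k * d k * b k j := by
  intro n
  induction n with
  | zero =>
    intro p _ z _ _
    exact ⟨1, 1, fun _ => 1, ⟨fun i => i.elim0, fun i => i.elim0⟩,
      ⟨fun i => i.elim0, fun i => i.elim0⟩, fun i => i.elim0, fun i => i.elim0⟩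
  | succ n ih =>
    intro p hp z hd ht
    have h0 := hd 0
    have hdiag : ∀ i : Fin n, z i.succ 0 * z 0 i.succ = 0 := by
      intro i
      rcases lt_or_gt_of_ne (hp.ne (Fin.succ_ne_zero i)) with h | h
      · rw [ht _ _ h, zero_mul]
      · rw [ht _ _ h, mul_zero]
    obtain ⟨a, b, d, ⟨ha1, ha0⟩, ⟨hb1, hb0⟩, hd', hz⟩ := ih (fun i => p i.succ)
      (fun i j h => Fin.succ_injective _ (hp h))
      (Matrix.of fun i j => z i.succ j.succ - z i.succ 0 * z 0 j.succ / z 0 0)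
      (by
        intro i
        simpa [hdiag i] using hd i.succ)
      (by
        intro i j h
        have hzero : z i.succ 0 * z 0 j.succ = 0 := by
          rcases lt_or_ge (p i.succ) (p 0) with h' | h'
          · rw [ht _ _ h', zero_mul]
          · rw [ht _ _ (h'.trans_lt h), mul_zero]
        simp [hzero, ht _ _ h])
    refine ⟨Matrix.of (Fin.cons (Fin.cons 1 fun _ => 0)
        fun i => Fin.cons (z i.succ 0 / z 0 0) (a i)),
      Matrix.of (Fin.cons (Fin.cons 1 fun j => z 0 j.succ / z 0 0)
        fun i => Fin.cons 0 (b i)),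
      Fin.cons (z 0 0) d, ⟨?_, ?_⟩, ⟨?_, ?_⟩, ?_, ?_⟩
    · intro i
      cases i using Fin.cases <;> simp [ha1]
    · intro i j h
      cases i using Fin.cases <;> cases j using Fin.cases <;> simp_all
    · intro i
      cases i using Fin.cases <;> simp [hb1]
    · intro i j h
      cases i using Fin.cases <;> cases j using Fin.cases <;> simp_all
    · intro i
      cases i using Fin.cases <;> simp [h0, hd']
    · intro i j
      rw [Fin.sum_univ_succ]
      cases i using Fin.cases with
      | zero =>
        cases j using Fin.cases with
        | zero => simp
        | succ j => simp; field_simp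
      | succ i =>
        cases j using Fin.cases with
        | zero => simp; field_simp
        | succ j =>
          have := hz i j
          simp only [Matrix.of_apply] at this
          simp only [Matrix.of_apply, Fin.cons_zero, Fin.cons_succ, ← this]
          field_simp
          ring

/-- The unitriangular factors of a Gaussian decomposition inherit triangularity with respect to
any relabelling of the indices. -/
theorem triangular_of_gauss {α : Type*} [LinearOrder α] :
    ∀ {n : ℕ} (p : Fin n → α) (z a b : Mat n) (d : Fin n → ℝ),
      (∀ i j, p i < p j → z i j = 0) → lowerUni a → upperUni b → (∀ i, d i ≠ 0) →
      (∀ i j, z i j = ∑ k, a i k * d k * b k j) →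
      (∀ i j, p i < p j → a i j = 0) ∧ (∀ i j, p i < p j → b i j = 0) := by
  intro n
  induction n with
  | zero => exact fun p z a b d _ _ _ _ _ => ⟨fun i => i.elim0, fun i => i.elim0⟩
  | succ n ih =>
    rintro p z a b d ht ⟨ha1, ha0⟩ ⟨hb1, hb0⟩ hd hz
    have hcol : ∀ i, z i 0 = a i 0 * d 0 := by
      intro i
      rw [hz, Fin.sum_univ_succ]
      simp [hb1, hb0 _ _ (Fin.succ_pos _)]
    have hrow : ∀ j, z 0 j = d 0 * b 0 j := by
      intro j
      rw [hz, Fin.sum_univ_succ]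
      simp [ha1, ha0 _ _ (Fin.succ_pos _)]
    have hac : ∀ i, p i < p 0 → a i 0 = 0 := fun i h =>
      (mul_eq_zero.1 ((hcol i).symm.trans (ht _ _ h))).resolve_right (hd 0)
    have hbr : ∀ j, p 0 < p j → b 0 j = 0 := fun j h =>
      (mul_eq_zero.1 ((hrow j).symm.trans (ht _ _ h))).resolve_left (hd 0)
    obtain ⟨iha, ihb⟩ := ih (fun i => p i.succ)
      (Matrix.of fun i j => z i.succ j.succ - a i.succ 0 * d 0 * b 0 j.succ)
      (Matrix.of fun i j => a i.succ j.succ) (Matrix.of fun i j => b i.succ j.succ)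
      (fun i => d i.succ)
      (by
        intro i j h
        have hzero : a i.succ 0 * d 0 * b 0 j.succ = 0 := by
          rcases lt_or_ge (p i.succ) (p 0) with h' | h'
          · rw [hac _ h', zero_mul, zero_mul]
          · rw [hbr _ (h'.trans_lt h), mul_zero]
        simp [hzero, ht _ _ h])
      ⟨fun i => ha1 _, fun i j h => ha0 _ _ (Fin.succ_lt_succ_iff.2 h)⟩
      ⟨fun i => hb1 _, fun i j h => hb0 _ _ (Fin.succ_lt_succ_iff.2 h)⟩
      (fun i => hd _)
      (by
        intro i j
        simp only [Matrix.of_apply]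
        rw [hz, Fin.sum_univ_succ]
        ring)
    constructor
    · intro i j h
      cases j using Fin.cases with
      | zero => exact hac i h
      | succ j =>
        cases i using Fin.cases with
        | zero => exact ha0 _ _ (Fin.succ_pos _)
        | succ i => exact iha i j h
    · intro i j h
      cases i using Fin.cases with
      | zero => exact hbr j h
      | succ i =>
        cases j using Fin.cases with
        | zero => exact hb0 _ _ (Fin.succ_pos _)
        | succ j => exact ihb i j h

theorem permMat_mul_apply {n : ℕ} (w : Equiv.Perm (Fin n)) (z : Mat n) (i j : Fin n) :
    (permMat w * z) i j = z (w⁻¹ i) j := by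
  have h : ∀ k, i = w k ↔ w⁻¹ i = k := fun k => Equiv.Perm.inv_eq_iff_eq.symm
  simp [Matrix.mul_apply, permMat, h]

theorem mul_permMat_apply {n : ℕ} (w : Equiv.Perm (Fin n)) (z : Mat n) (i j : Fin n) :
    (z * permMat w) i j = z i (w j) := by
  simp [Matrix.mul_apply, permMat]

theorem permMat_conj_apply {n : ℕ} (w : Equiv.Perm (Fin n)) (z : Mat n) (i j : Fin n) :
    (permMat w * z * permMat w⁻¹) i j = z (w⁻¹ i) (w⁻¹ j) := by
  rw [mul_permMat_apply, permMat_mul_apply]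

theorem permMat_inv_conj_apply {n : ℕ} (w : Equiv.Perm (Fin n)) (z : Mat n) (i j : Fin n) :
    (permMat w⁻¹ * z * permMat w) i j = z (w i) (w j) := by
  rw [mul_permMat_apply, permMat_mul_apply, inv_inv]

theorem mul_mul_apply_of_diagInv {n : ℕ} (a d b : Mat n) (hd : diagInv d) (i j : Fin n) :
    (a * d * b) i j = ∑ k, a i k * d k k * b k j := by
  rw [Matrix.mul_apply]
  refine Finset.sum_congr rfl fun k _ => ?_
  rw [Matrix.mul_apply, Finset.sum_eq_single k]
  · intro l _ hl
    rw [hd.2 _ _ hl, mul_zero]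
  · simp

theorem diagInv_diagonal {n : ℕ} {d : Fin n → ℝ} (hd : ∀ i, d i ≠ 0) :
    diagInv (Matrix.diagonal d) := by
  refine ⟨?_, fun i j h => Matrix.diagonal_apply_ne _ h⟩
  rw [Matrix.det_diagonal, isUnit_iff_ne_zero]
  exact Finset.prod_ne_zero_iff.2 fun i _ => hd i

theorem diagInv_apply_self_ne_zero {n : ℕ} {d : Mat n} (hd : diagInv d) (i : Fin n) :
    d i i ≠ 0 := by
  have h := hd.1
  rw [Matrix.det_of_isUpperTriangular fun i j (hij : j < i) => hd.2 i j hij.ne',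
    isUnit_iff_ne_zero] at h
  exact Finset.prod_ne_zero_iff.1 h i (Finset.mem_univ i)

theorem gaussMinus_gaussPlus_spec {n : ℕ} {z : Mat n} (h : hasGauss z) :
    ∃ d, lowerUni (gaussMinus z) ∧ diagInv d ∧ upperUni (gaussPlus z) ∧
      z = gaussMinus z * d * gaussPlus z := by
  simp only [gaussMinus, gaussPlus, dif_pos h]
  exact ⟨_, h.choose_spec.choose_spec.choose_spec⟩

/-- The Gaussian factors of a matrix that is triangular for an injective relabelling of the
indices are triangular for it as well. -/
theorem hasGauss_and_triangular {α : Type*} [LinearOrder α] {n : ℕ} (p : Fin n → α)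
    (hp : Function.Injective p) (z : Mat n) (hd : ∀ i, z i i ≠ 0)
    (ht : ∀ i j, p i < p j → z i j = 0) :
    hasGauss z ∧
      ((∀ i, gaussMinus z i i = 1) ∧ ∀ i j, p i < p j → gaussMinus z i j = 0) ∧
      ((∀ i, gaussPlus z i i = 1) ∧ ∀ i j, p i < p j → gaussPlus z i j = 0) := by
  have hg : hasGauss z := by
    obtain ⟨a, b, d, ha, hb, hd', hz⟩ := exists_gauss_of_triangular p hp z hd ht
    refine ⟨a, Matrix.diagonal d, b, ha, diagInv_diagonal hd', hb, ?_⟩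
    ext i j
    rw [mul_mul_apply_of_diagInv _ _ _ (diagInv_diagonal hd'), hz]
    simp
  obtain ⟨d, ha, hd', hb, hz⟩ := gaussMinus_gaussPlus_spec hg
  obtain ⟨h₁, h₂⟩ := triangular_of_gauss p z _ _ (fun k => d k k) ht ha hb
    (diagInv_apply_self_ne_zero hd')
    (fun i j => (congrFun (congrFun hz i) j).trans (mul_mul_apply_of_diagInv _ _ _ hd' i j))
  exact ⟨hg, ⟨ha.1, h₁⟩, ⟨hb.1, h₂⟩⟩

theorem exists_lowerUni_conj {n : ℕ} (w : Equiv.Perm (Fin n)) (x : Mat n)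
    (h1 : ∀ i, x i i = 1) (h0 : ∀ i j, w i < w j → x i j = 0) :
    ∃ m : Mat n, lowerUni m ∧ x = permMat w⁻¹ * m * permMat w := by
  refine ⟨permMat w * x * permMat w⁻¹, ⟨fun i => ?_, fun i j h => ?_⟩, ?_⟩
  · rw [permMat_conj_apply, h1]
  · rw [permMat_conj_apply]
    exact h0 _ _ (by simpa using h)
  · ext i j
    rw [permMat_inv_conj_apply, permMat_conj_apply]
    simp

theorem exists_upperUni_conj {n : ℕ} (w : Equiv.Perm (Fin n)) (x : Mat n)
    (h1 : ∀ i, x i i = 1) (h0 : ∀ i j, w j < w i → x i j = 0) :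
    ∃ m : Mat n, upperUni m ∧ x = permMat w⁻¹ * m * permMat w := by
  refine ⟨permMat w * x * permMat w⁻¹, ⟨fun i => ?_, fun i j h => ?_⟩, ?_⟩
  · rw [permMat_conj_apply, h1]
  · rw [permMat_conj_apply]
    exact h0 _ _ (by simpa using h)
  · ext i j
    rw [permMat_inv_conj_apply, permMat_conj_apply]
    simp

theorem statement1 (n : ℕ) (hn : 1 ≤ n) (w : Equiv.Perm (Fin n)) (z : Mat n)
    (hz : IsUnit z.det) :
    (lowerTriInv (permMat w * z * permMat w⁻¹) →
      hasGauss z ∧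
      (∃ m : Mat n, lowerUni m ∧ gaussMinus z = permMat w⁻¹ * m * permMat w) ∧
      (∃ m : Mat n, lowerUni m ∧ gaussPlus z = permMat w⁻¹ * m * permMat w)) ∧
    (upperTriInv (permMat w * z * permMat w⁻¹) →
      hasGauss z ∧
      (∃ m : Mat n, upperUni m ∧ gaussMinus z = permMat w⁻¹ * m * permMat w) ∧
      (∃ m : Mat n, upperUni m ∧ gaussPlus z = permMat w⁻¹ * m * permMat w)) := by
  constructor
  · rintro ⟨hdet, ht⟩
    rw [Matrix.det_of_isLowerTriangular _ fun i j h => ht i j h, isUnit_iff_ne_zero] at hdet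
    have hd : ∀ i, z i i ≠ 0 := fun i => by
      simpa [permMat_conj_apply] using Finset.prod_ne_zero_iff.1 hdet (w i) (Finset.mem_univ _)
    obtain ⟨hg, ha, hb⟩ := hasGauss_and_triangular w w.injective z hd
      (fun i j h => by simpa [permMat_conj_apply] using ht _ _ h)
    exact ⟨hg, exists_lowerUni_conj w _ ha.1 ha.2, exists_lowerUni_conj w _ hb.1 hb.2⟩
  · rintro ⟨hdet, ht⟩
    rw [Matrix.det_of_isUpperTriangular fun i j h => ht i j h, isUnit_iff_ne_zero] at hdet
    have hd : ∀ i, z i i ≠ 0 := fun i => by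
      simpa [permMat_conj_apply] using Finset.prod_ne_zero_iff.1 hdet (w i) (Finset.mem_univ _)
    obtain ⟨hg, ha, hb⟩ := hasGauss_and_triangular (fun i => OrderDual.toDual (w i))
      (fun i j h => w.injective h) z hd
      (fun i j h => by simpa [permMat_conj_apply] using ht _ _ (OrderDual.toDual_lt_toDual.1 h))
    exact ⟨hg, exists_upperUni_conj w _ ha.1 fun i j h => ha.2 i j h,
      exists_upperUni_conj w _ hb.1 fun i j h => hb.2 i j h⟩

end BruhatTNN
end

section
/- Let w ∈ S_n, x_w ∈ N^w, and b_- ∈ B_-. If the product x_w b_- admits a Gaussian decomposition, then [x_w b_-]_+ ∈ N^w. -/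
open scoped Classical

namespace BruhatTNN

theorem lowerTriInv.blockTriangular {n : ℕ} {x : Mat n} (hx : lowerTriInv x) :
    x.BlockTriangular OrderDual.toDual :=
  fun i j hij => hx.2 i j hij

theorem lowerTriInv.mul {n : ℕ} {x y : Mat n} (hx : lowerTriInv x) (hy : lowerTriInv y) :
    lowerTriInv (x * y) :=
  ⟨by rw [Matrix.det_mul]; exact hx.1.mul hy.1,
    fun _ _ hij => (hx.blockTriangular.mul hy.blockTriangular) hij⟩

theorem lowerTriInv.inv {n : ℕ} {x : Mat n} (hx : lowerTriInv x) : lowerTriInv x⁻¹ := by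
  have : Invertible x := x.invertibleOfIsUnitDet hx.1
  exact ⟨Matrix.isUnit_nonsing_inv_det x hx.1,
    fun _ _ hij => Matrix.blockTriangular_inv_of_blockTriangular hx.blockTriangular hij⟩

theorem lowerUni.lowerTriInv {n : ℕ} {x : Mat n} (hx : lowerUni x) : lowerTriInv x := by
  refine ⟨?_, hx.2⟩
  rw [Matrix.det_of_isLowerTriangular x fun i j hij => hx.2 i j hij]
  simp [hx.1]

theorem diagInv.lowerTriInv {n : ℕ} {x : Mat n} (hx : diagInv x) : lowerTriInv x :=
  ⟨hx.1, fun i j hij => hx.2 i j hij.ne⟩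

theorem gaussPlus_spec {n : ℕ} {x : Mat n} (h : hasGauss x) :
    ∃ a d : Mat n, lowerUni a ∧ diagInv d ∧ upperUni (gaussPlus x) ∧
      x = a * d * gaussPlus x := by
  rw [gaussPlus, dif_pos h]
  exact ⟨_, _, h.choose_spec.choose_spec.choose_spec⟩

theorem statement3 (n : ℕ) (hn : 1 ≤ n) (w : Equiv.Perm (Fin n)) (xw : Mat n)
    (hxw : xw ∈ Ncell w) (bm : Mat n) (hbm : lowerTriInv bm)
    (hg : hasGauss (xw * bm)) :
    gaussPlus (xw * bm) ∈ Ncell w := by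
  obtain ⟨-, b₁, b₂, hb₁, hb₂, rfl⟩ := hxw
  obtain ⟨a, d, ha, hd, hb, hx⟩ := gaussPlus_spec hg
  have had : lowerTriInv (a * d) := ha.lowerTriInv.mul hd.lowerTriInv
  refine ⟨hb, (a * d)⁻¹ * b₁, b₂ * bm, had.inv.mul hb₁, hb₂.mul hbm, ?_⟩
  calc gaussPlus (b₁ * permMat w * b₂ * bm)
      = (a * d)⁻¹ * (a * d * gaussPlus (b₁ * permMat w * b₂ * bm)) :=
        (Matrix.nonsing_inv_mul_cancel_left _ _ had.1).symm
    _ = (a * d)⁻¹ * (b₁ * permMat w * b₂ * bm) := by rw [← hx]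
    _ = (a * d)⁻¹ * b₁ * permMat w * (b₂ * bm) := by simp only [Matrix.mul_assoc]

end BruhatTNN
end

section
/- For every u ∈ S_n and every x ∈ B_- u B_-, the matrix x u⁻¹ admits a Gaussian decomposition; that is, B_- u B_- ⊆ G_0 u. In particular, N^u ⊆ G_0 u. -/
open scoped Classical

namespace BruhatTNN

/-- A matrix which becomes lower triangular with nonzero diagonal after reordering the indices
along an injective `σ` is the product of a lower triangular matrix with nonzero diagonal and an
upper unitriangular one. -/
theorem exists_lower_mul_upperUni {n : ℕ} (M : Mat n) (σ : Fin n → ℕ)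
    (hσ : Function.Injective σ) (hdiag : ∀ i, M i i ≠ 0)
    (htri : ∀ i j, σ i < σ j → M i j = 0) :
    ∃ T U : Mat n, ((∀ i, T i i ≠ 0) ∧ ∀ i j : Fin n, i < j → T i j = 0) ∧ upperUni U ∧
      M = T * U := by
  induction n with
  | zero =>
    exact ⟨M, M, ⟨fun i => i.elim0, fun i => i.elim0⟩, ⟨fun i => i.elim0, fun i => i.elim0⟩,
      Matrix.ext fun i => i.elim0⟩
  | succ n ih =>
    have h0 : M 0 0 ≠ 0 := hdiag 0
    have hc : ∀ i j : Fin n, σ i.succ ≤ σ j.succ → M i.succ 0 * (M 0 j.succ / M 0 0) = 0 := by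
      intro i j hij
      rcases lt_or_ge (σ i.succ) (σ 0) with h | h
      · simp [htri _ _ h]
      · have hne : σ 0 ≠ σ i.succ := fun h => (Fin.succ_ne_zero i) (hσ h).symm
        simp [htri 0 j.succ (by omega)]
    obtain ⟨T, U, ⟨hTd, hT⟩, ⟨hUd, hU⟩, hTU⟩ :=
      ih (Matrix.of fun i j => M i.succ j.succ - M i.succ 0 * (M 0 j.succ / M 0 0))
        (fun i => σ i.succ) (hσ.comp (Fin.succ_injective n))
        (fun i => by simpa [Matrix.of_apply, hc i i le_rfl] using hdiag i.succ)
        (fun i j h => by simp only [Matrix.of_apply, hc i j h.le, htri _ _ h, sub_zero])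
    have hS : ∀ i j : Fin n, M i.succ j.succ =
        M i.succ 0 * (M 0 j.succ / M 0 0) + ∑ k, T i k * U k j := fun i j => by
      rw [← Matrix.mul_apply, ← hTU, Matrix.of_apply]
      ring
    refine ⟨Matrix.of (Fin.cons (Fin.cons (M 0 0) 0) fun i => Fin.cons (M i.succ 0) (T i)),
      Matrix.of (Fin.cons (Fin.cons 1 fun j => M 0 j.succ / M 0 0) fun i => Fin.cons 0 (U i)),
      ⟨?_, ?_⟩, ⟨?_, ?_⟩, ?_⟩
    · intro i
      cases i using Fin.cases <;> simp [h0, hTd]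
    · intro i j h
      cases i using Fin.cases <;> cases j using Fin.cases <;> simp_all
    · intro i
      cases i using Fin.cases <;> simp [hUd]
    · intro i j h
      cases i using Fin.cases <;> cases j using Fin.cases <;> simp_all
    · ext i j
      rw [Matrix.mul_apply, Fin.sum_univ_succ]
      cases i using Fin.cases <;> cases j using Fin.cases <;>
        simp [h0, hS, mul_div_cancel₀]

theorem lowerTriInv_iff {n : ℕ} (x : Mat n) :
    lowerTriInv x ↔ (∀ i, x i i ≠ 0) ∧ ∀ i j : Fin n, i < j → x i j = 0 := by
  refine and_congr_left fun h => ?_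
  rw [Matrix.det_of_isLowerTriangular x fun i j hij => h i j hij, isUnit_iff_ne_zero,
    Finset.prod_ne_zero_iff]
  simp

theorem lowerTriInv.hasGauss_mul {n : ℕ} {t b : Mat n} (ht : lowerTriInv t) (hb : upperUni b) :
    hasGauss (t * b) := by
  obtain ⟨hd, hl⟩ := (lowerTriInv_iff t).1 ht
  refine ⟨t * Matrix.diagonal fun i => (t i i)⁻¹, Matrix.diagonal fun i => t i i, b,
    ⟨fun i => ?_, fun i j h => ?_⟩, ⟨?_, fun i j h => Matrix.diagonal_apply_ne _ h⟩, hb, ?_⟩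
  · simp [Matrix.mul_diagonal, hd]
  · simp [Matrix.mul_diagonal, hl i j h]
  · simp [Matrix.det_diagonal, Finset.prod_ne_zero_iff, hd]
  · simp [Matrix.mul_assoc, hd]

theorem permMat_mul_mul_permMat_inv_apply {n : ℕ} (u : Equiv.Perm (Fin n)) (x : Mat n)
    (i j : Fin n) : (permMat u * x * permMat u⁻¹) i j = x (u⁻¹ i) (u⁻¹ j) := by
  have h : ∀ k, i = u k ↔ k = u⁻¹ i := fun k => by
    rw [Equiv.Perm.eq_inv_iff_eq, eq_comm]
  simp [Matrix.mul_apply, permMat, h]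

theorem hasGauss_mul_permMat_inv {n : ℕ} {u : Equiv.Perm (Fin n)} {x : Mat n}
    (hx : x ∈ doubleCosetBm u) : hasGauss (x * permMat u⁻¹) := by
  obtain ⟨b₁, b₂, h₁, h₂, rfl⟩ := hx
  obtain ⟨hd, hl⟩ := (lowerTriInv_iff b₂).1 h₂
  obtain ⟨T, U, hT, hU, hTU⟩ := exists_lower_mul_upperUni (permMat u * b₂ * permMat u⁻¹)
    (fun i => (u⁻¹ i : Fin n).val) (Fin.val_injective.comp u⁻¹.injective)
    (fun i => by rw [permMat_mul_mul_permMat_inv_apply]; exact hd _)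
    (fun i j h => by rw [permMat_mul_mul_permMat_inv_apply]; exact hl _ _ h)
  have h : b₁ * permMat u * b₂ * permMat u⁻¹ = b₁ * T * U := by
    rw [Matrix.mul_assoc b₁ T U, ← hTU]
    simp only [Matrix.mul_assoc]
  rw [h]
  exact (h₁.mul ((lowerTriInv_iff T).2 hT)).hasGauss_mul hU

theorem statement6 (n : ℕ) (hn : 1 ≤ n) (u : Equiv.Perm (Fin n)) :
    (∀ x ∈ doubleCosetBm u, hasGauss (x * permMat u⁻¹)) ∧
    (∀ x ∈ Ncell u, hasGauss (x * permMat u⁻¹)) := by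
  exact ⟨fun _ hx => hasGauss_mul_permMat_inv hx, fun _ hx => hasGauss_mul_permMat_inv hx.2⟩

end BruhatTNN
end
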